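/- arXiv:1506.00967 — 9 statements merged into one kernel-verified Lean document; each statement's English description precedes it below -/
import Mathlib

section
/- For all nonzero real numbers Ω_U, Ω_V, Ω_W, the real quadratic form C on ℝ³ defined by C(p, q, r) = p²/Ω_W² + q²/Ω_V² + r²/Ω_U² − 2pq/(Ω_W·Ω_V) − 2pr/(Ω_W·Ω_U) − 2qr/(Ω_V·Ω_U) is equivalent over ℝ to the diagonal quadratic form x² + y² − z²; in particular it is nondegenerate with signature (2, 1), independently of the values of Ω_U, Ω_V, Ω_W. -/
/-- The quadratic form `C` of the conic inscribed in the triangle of tangent lines is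
equivalent over ℝ (by an invertible linear change of variables) to `x² + y² − z²`; in
particular it is nondegenerate, of signature (2,1), for all nonzero `Ω_U, Ω_V, Ω_W`. -/
theorem stmt_2 (ΩU ΩV ΩW : ℝ) (hU : ΩU ≠ 0) (hV : ΩV ≠ 0) (hW : ΩW ≠ 0)
    (C : (Fin 3 → ℝ) → ℝ)
    (hC : ∀ v : Fin 3 → ℝ, C v =
      (v 0) ^ 2 / ΩW ^ 2 + (v 1) ^ 2 / ΩV ^ 2 + (v 2) ^ 2 / ΩU ^ 2
        - 2 * (v 0) * (v 1) / (ΩW * ΩV) - 2 * (v 0) * (v 2) / (ΩW * ΩU)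
        - 2 * (v 1) * (v 2) / (ΩV * ΩU)) :
    (∃ e : (Fin 3 → ℝ) ≃ₗ[ℝ] (Fin 3 → ℝ),
        ∀ v : Fin 3 → ℝ, C (e v) = (v 0) ^ 2 + (v 1) ^ 2 - (v 2) ^ 2) ∧
    (∀ v : Fin 3 → ℝ, (∀ w : Fin 3 → ℝ, C (v + w) = C v + C w) → v = 0) := by
  constructor
  · refine ⟨{
      toFun := fun v => ![ΩW * ((v 0 + v 2) / 2), ΩV * ((v 2 - v 0) / 2), ΩU * (v 1 + v 2)]
      map_add' := fun v w => by ext i; fin_cases i <;> simp <;> ring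
      map_smul' := fun t v => by ext i; fin_cases i <;> simp <;> ring
      invFun := fun v =>
        ![v 0 / ΩW - v 1 / ΩV, v 2 / ΩU - v 0 / ΩW - v 1 / ΩV, v 0 / ΩW + v 1 / ΩV]
      left_inv := fun v => by ext i; fin_cases i <;> simp <;> field_simp <;> ring
      right_inv := fun v => by ext i; fin_cases i <;> simp <;> field_simp }, fun v => ?_⟩
    rw [hC]
    simp only [LinearEquiv.coe_mk, LinearMap.coe_mk, AddHom.coe_mk, Matrix.cons_val]
    field_simp
    ring
  · intro v hv
    obtain ⟨a, ha⟩ : ∃ a, v 0 = ΩW * a := ⟨v 0 / ΩW, by field_simp⟩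
    obtain ⟨b, hb⟩ : ∃ b, v 1 = ΩV * b := ⟨v 1 / ΩV, by field_simp⟩
    obtain ⟨c, hc⟩ : ∃ c, v 2 = ΩU * c := ⟨v 2 / ΩU, by field_simp⟩
    have h0 := hv ![ΩW, 0, 0]
    have h1 := hv ![0, ΩV, 0]
    have h2 := hv ![0, 0, ΩU]
    simp only [hC, Pi.add_apply, Matrix.cons_val, ha, hb, hc, add_zero, mul_zero, zero_mul, zero_div,
      ne_eq, OfNat.ofNat_ne_zero, not_false_eq_true, zero_pow, sub_zero, zero_add] at h0 h1 h2
    field_simp at h0 h1 h2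
    have a0 : a = 0 := by linarith
    have b0 : b = 0 := by linarith
    have c0 : c = 0 := by linarith
    ext i
    fin_cases i <;> simp [ha, hb, hc, a0, b0, c0]
end

section
/- Let Ω_U, Ω_V, Ω_W be nonzero real numbers and λ a real number, and let Q be the real quadratic form on ℝ⁴ defined by Q(p, q, r, t) = p²/Ω_W² + q²/Ω_V² + r²/Ω_U² − 2pq/(Ω_W·Ω_V) − 2pr/(Ω_W·Ω_U) − 2qr/(Ω_V·Ω_U) + λt². If λ > 0, then Q is equivalent over ℝ to the diagonal form x² + y² + z² − w² (signature (3,1)); if λ < 0, then Q is equivalent over ℝ to the diagonal form x² + y² − z² − w² (signature (2,2)). -/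
/-- The linear change of variables with `e v = (a (v₃ + v₀) / 2, b (v₃ - v₀) / 2, c (v₁ + v₃), v₂ / s)`;
it diagonalizes `p² / a² + q² / b² + r² / c² - 2pq / (ab) - 2pr / (ac) - 2qr / (bc) + l t²`
when `s² = |l|`. -/
noncomputable def diagonalizingEquiv (a b c s : ℝ) (ha : a ≠ 0) (hb : b ≠ 0) (hc : c ≠ 0)
    (hs : s ≠ 0) : (Fin 4 → ℝ) ≃ₗ[ℝ] (Fin 4 → ℝ) where
  toFun v := ![a * (v 3 + v 0) / 2, b * (v 3 - v 0) / 2, c * (v 1 + v 3), v 2 / s]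
  invFun u := ![u 0 / a - u 1 / b, u 2 / c - u 0 / a - u 1 / b, s * u 3, u 0 / a + u 1 / b]
  map_add' u v := by
    ext i
    fin_cases i <;> simp <;> ring
  map_smul' k v := by
    ext i
    fin_cases i <;> simp <;> ring
  left_inv v := by
    ext i
    fin_cases i <;> simp <;> field_simp <;> ring
  right_inv u := by
    ext i
    fin_cases i <;> simp <;> field_simp <;> ring

theorem form_diagonalizingEquiv (a b c s l : ℝ) (ha : a ≠ 0) (hb : b ≠ 0) (hc : c ≠ 0)
    (hs : s ≠ 0) (v u : Fin 4 → ℝ) (hu : u = diagonalizingEquiv a b c s ha hb hc hs v) :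
    (u 0) ^ 2 / a ^ 2 + (u 1) ^ 2 / b ^ 2 + (u 2) ^ 2 / c ^ 2
        - 2 * (u 0) * (u 1) / (a * b) - 2 * (u 0) * (u 2) / (a * c)
        - 2 * (u 1) * (u 2) / (b * c) + l * (u 3) ^ 2 =
      (v 0) ^ 2 + (v 1) ^ 2 + l / s ^ 2 * (v 2) ^ 2 - (v 3) ^ 2 := by
  have h0 : u 0 = a * (v 3 + v 0) / 2 := by rw [hu]; rfl
  have h1 : u 1 = b * (v 3 - v 0) / 2 := by rw [hu]; rfl
  have h2 : u 2 = c * (v 1 + v 3) := by rw [hu]; rfl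
  have h3 : u 3 = v 2 / s := by rw [hu]; rfl
  rw [h0, h1, h2, h3]
  field_simp
  ring


/-- The point quadratic form `Q` of the quadric patch of Theorem 1: if `λ > 0` it is
equivalent over ℝ to `x² + y² + z² − w²` (oval quadrics, signature (3,1)); if `λ < 0`
it is equivalent to `x² + y² − z² − w²` (ruled quadrics, signature (2,2)). -/
theorem stmt_3 (ΩU ΩV ΩW lam : ℝ) (hU : ΩU ≠ 0) (hV : ΩV ≠ 0) (hW : ΩW ≠ 0)
    (Q : (Fin 4 → ℝ) → ℝ)
    (hQ : ∀ v : Fin 4 → ℝ, Q v =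
      (v 0) ^ 2 / ΩW ^ 2 + (v 1) ^ 2 / ΩV ^ 2 + (v 2) ^ 2 / ΩU ^ 2
        - 2 * (v 0) * (v 1) / (ΩW * ΩV) - 2 * (v 0) * (v 2) / (ΩW * ΩU)
        - 2 * (v 1) * (v 2) / (ΩV * ΩU) + lam * (v 3) ^ 2) :
    (0 < lam → ∃ e : (Fin 4 → ℝ) ≃ₗ[ℝ] (Fin 4 → ℝ),
        ∀ v : Fin 4 → ℝ,
          Q (e v) = (v 0) ^ 2 + (v 1) ^ 2 + (v 2) ^ 2 - (v 3) ^ 2) ∧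
    (lam < 0 → ∃ e : (Fin 4 → ℝ) ≃ₗ[ℝ] (Fin 4 → ℝ),
        ∀ v : Fin 4 → ℝ,
          Q (e v) = (v 0) ^ 2 + (v 1) ^ 2 - (v 2) ^ 2 - (v 3) ^ 2) := by
  constructor
  · intro hl
    refine ⟨diagonalizingEquiv ΩW ΩV ΩU √lam hW hV hU (Real.sqrt_pos.2 hl).ne', fun v => ?_⟩
    rw [hQ, form_diagonalizingEquiv ΩW ΩV ΩU √lam lam hW hV hU _ v _ rfl,
      Real.sq_sqrt hl.le, div_self hl.ne']
    ring
  · intro hl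
    have hl' : 0 < -lam := neg_pos.2 hl
    refine ⟨diagonalizingEquiv ΩW ΩV ΩU √(-lam) hW hV hU (Real.sqrt_pos.2 hl').ne', fun v => ?_⟩
    rw [hQ, form_diagonalizingEquiv ΩW ΩV ΩU √(-lam) lam hW hV hU _ v _ rfl,
      Real.sq_sqrt hl'.le, div_neg, div_self hl.ne]
    ring
end

section
/- Let E be a real vector space, let p, q : E → ℝ be affine maps, let P, Q, R, S ∈ E, and let ω₀₀₂, ω₀₂₀, ω₂₀₀, ω_u, ω_v, ω_w be nonzero real numbers satisfying: p(P) = 0, q(Q) = 0, (ω₀₂₀/ω_u)·p(Q) = p(S) = (ω₂₀₀/ω_v)·p(R), and (ω₂₀₀/ω_w)·q(R) = q(S) = (ω₀₀₂/ω_u)·q(P). Assume Ω_U := ω₀₀₂·ω_w + ω₀₂₀·ω_v − ω₂₀₀·ω_u ≠ 0 and define the point U := (ω₀₀₂·ω_w·P + ω₀₂₀·ω_v·Q − ω₂₀₀·ω_u·R)/Ω_U (a barycentric combination of P, Q, R). Then p(U) = 0 and q(U) = 0. -/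
/-- An affine form commutes with a normalized combination `W⁻¹ • (a • P + b • Q - c • R)`
of total weight `W = a + b - c`. -/
theorem AffineMap.apply_inv_smul_add_sub {E : Type*} [AddCommGroup E] [Module ℝ E]
    (f : E →ᵃ[ℝ] ℝ) (P Q R : E) {a b c W : ℝ} (hW : W = a + b - c) (hW0 : W ≠ 0) :
    f (W⁻¹ • (a • P + b • Q - c • R)) = W⁻¹ * (a * f P + b * f Q - c * f R) := by
  have h (x : E) : f x = f.linear x + f 0 := congrFun f.decomp x
  rw [h (W⁻¹ • _), h P, h Q, h R]
  simp only [map_smul, map_add, map_sub, smul_eq_mul]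
  field_simp
  rw [hW]
  ring

/-- The point `U` given by formula (UVW) of the paper lies on both tangent planes
`p = 0` and `q = 0`. -/
theorem stmt_7 (E : Type*) [AddCommGroup E] [Module ℝ E]
    (p q : E →ᵃ[ℝ] ℝ) (P Q R S : E)
    (ω002 ω020 ω200 ωu ωv ωw : ℝ)
    (h002 : ω002 ≠ 0) (h020 : ω020 ≠ 0) (h200 : ω200 ≠ 0)
    (hu : ωu ≠ 0) (hv : ωv ≠ 0) (hw : ωw ≠ 0)
    (hpP : p P = 0) (hqQ : q Q = 0)
    (hp1 : (ω020 / ωu) * p Q = p S) (hp2 : p S = (ω200 / ωv) * p R)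
    (hq1 : (ω200 / ωw) * q R = q S) (hq2 : q S = (ω002 / ωu) * q P)
    (ΩU : ℝ) (hΩU : ΩU = ω002 * ωw + ω020 * ωv - ω200 * ωu) (hΩU0 : ΩU ≠ 0)
    (U : E)
    (hUdef : U = (ΩU)⁻¹ • ((ω002 * ωw) • P + (ω020 * ωv) • Q - (ω200 * ωu) • R)) :
    p U = 0 ∧ q U = 0 := by
  subst hUdef
  rw [p.apply_inv_smul_add_sub P Q R hΩU hΩU0, q.apply_inv_smul_add_sub P Q R hΩU hΩU0,
    hpP, hqQ]
  have hp := hp1.trans hp2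
  have hq := hq1.trans hq2
  field_simp at hp hq
  constructor
  · apply mul_eq_zero_of_right
    linear_combination hp
  · apply mul_eq_zero_of_right
    linear_combination -hq
end

section
/- Let E be a real vector space, let p, q, r : E → ℝ be affine maps, let P, Q, R, S ∈ E, and let ω₀₀₂, ω₀₂₀, ω₂₀₀, ω_u, ω_v, ω_w be nonzero real numbers satisfying p(P) = 0, q(Q) = 0, r(R) = 0 and the ratio relations (ω₀₂₀/ω_u)·p(Q) = p(S) = (ω₂₀₀/ω_v)·p(R), (ω₂₀₀/ω_w)·q(R) = q(S) = (ω₀₀₂/ω_u)·q(P), (ω₀₀₂/ω_v)·r(P) = r(S) = (ω₀₂₀/ω_w)·r(Q). Assume the numbers Ω_U := ω₀₀₂·ω_w + ω₀₂₀·ω_v − ω₂₀₀·ω_u, Ω_V := ω₀₀₂·ω_w − ω₀₂₀·ω_v + ω₂₀₀·ω_u, Ω_W := −ω₀₀₂·ω_w + ω₀₂₀·ω_v + ω₂₀₀·ω_u are nonzero, and define U := (ω₀₀₂·ω_w·P + ω₀₂₀·ω_v·Q − ω₂₀₀·ω_u·R)/Ω_U, V := (ω₀₀₂·ω_w·P −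 ω₀₂₀·ω_v·Q + ω₂₀₀·ω_u·R)/Ω_V, W := (−ω₀₀₂·ω_w·P + ω₀₂₀·ω_v·Q + ω₂₀₀·ω_u·R)/Ω_W. Then p(W) = (2·ω_u·ω_v/Ω_W)·p(S), q(V) = (2·ω_u·ω_w/Ω_V)·q(S), and r(U) = (2·ω_v·ω_w/Ω_U)·r(S). -/
/-- An affine map sends a normalised weighted combination of three points to the corresponding
weighted combination of its values. -/
theorem AffineMap.map_inv_smul_add_add {k E : Type*} [Field k] [AddCommGroup E] [Module k E]
    (f : E →ᵃ[k] k) (X Y Z : E) {a b c d : k} (hd : d = a + b + c) (hd0 : d ≠ 0) :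
    f (d⁻¹ • (a • X + b • Y + c • Z)) = (a * f X + b * f Y + c * f Z) / d := by
  have h (x : E) : f x = f.linear x + f 0 := congrFun f.decomp x
  rw [h, h X, h Y, h Z]
  simp only [map_smul, map_add, smul_eq_mul]
  field_simp
  rw [hd]
  ring

/-- Equation (SS) of the paper: the values of the tangent-plane forms `p, q, r` at the
points `W, V, U` of formula (UVW), in terms of their values at `S`. -/
theorem stmt_8 (E : Type*) [AddCommGroup E] [Module ℝ E]
    (p q r : E →ᵃ[ℝ] ℝ) (P Q R S : E)
    (ω002 ω020 ω200 ωu ωv ωw : ℝ)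
    (h002 : ω002 ≠ 0) (h020 : ω020 ≠ 0) (h200 : ω200 ≠ 0)
    (hu : ωu ≠ 0) (hv : ωv ≠ 0) (hw : ωw ≠ 0)
    (hpP : p P = 0) (hqQ : q Q = 0) (hrR : r R = 0)
    (hp1 : (ω020 / ωu) * p Q = p S) (hp2 : p S = (ω200 / ωv) * p R)
    (hq1 : (ω200 / ωw) * q R = q S) (hq2 : q S = (ω002 / ωu) * q P)
    (hr1 : (ω002 / ωv) * r P = r S) (hr2 : r S = (ω020 / ωw) * r Q)
    (ΩU ΩV ΩW : ℝ)
    (hΩU : ΩU = ω002 * ωw + ω020 * ωv - ω200 * ωu)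
    (hΩV : ΩV = ω002 * ωw - ω020 * ωv + ω200 * ωu)
    (hΩW : ΩW = -(ω002 * ωw) + ω020 * ωv + ω200 * ωu)
    (hΩU0 : ΩU ≠ 0) (hΩV0 : ΩV ≠ 0) (hΩW0 : ΩW ≠ 0)
    (U V W : E)
    (hUdef : U = (ΩU)⁻¹ • ((ω002 * ωw) • P + (ω020 * ωv) • Q - (ω200 * ωu) • R))
    (hVdef : V = (ΩV)⁻¹ • ((ω002 * ωw) • P - (ω020 * ωv) • Q + (ω200 * ωu) • R))
    (hWdef : W = (ΩW)⁻¹ • (-((ω002 * ωw) • P) + (ω020 * ωv) • Q + (ω200 * ωu) • R)) :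
    p W = (2 * ωu * ωv / ΩW) * p S ∧
    q V = (2 * ωu * ωw / ΩV) * q S ∧
    r U = (2 * ωv * ωw / ΩU) * r S := by
  refine ⟨?_, ?_, ?_⟩
  · rw [hWdef, ← neg_smul, p.map_inv_smul_add_add P Q R hΩW hΩW0, hpP]
    have hQ : ω020 * p Q = ωu * p S := by rw [← hp1]; field_simp
    have hR : ω200 * p R = ωv * p S := by rw [hp2]; field_simp
    field_simp
    linear_combination ωv * hQ + ωu * hR
  · rw [hVdef, sub_eq_add_neg, ← neg_smul,
      q.map_inv_smul_add_add P Q R (by rw [hΩV]; ring) hΩV0, hqQ]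
    have hR : ω200 * q R = ωw * q S := by rw [← hq1]; field_simp
    have hP : ω002 * q P = ωu * q S := by rw [hq2]; field_simp
    field_simp
    linear_combination ωu * hR + ωw * hP
  · rw [hUdef, sub_eq_add_neg, ← neg_smul,
      r.map_inv_smul_add_add P Q R (by rw [hΩU]; ring) hΩU0, hrR]
    have hP : ω002 * r P = ωv * r S := by rw [← hr1]; field_simp
    have hQ : ω020 * r Q = ωw * r S := by rw [hr2]; field_simp
    field_simp
    linear_combination ωw * hP + ωv * hQ
end

section
/- Let Ω_U, Ω_V, Ω_W be nonzero real numbers, let λ > 0 be real, set Σ := Ω_U·Ω_V + Ω_V·Ω_W + Ω_W·Ω_U, and let G be the real quadratic form on ℝ³ given by G(x, y, z) = x² + y² + z² − 2xy − 2xz − 2yz + λ·(Ω_W·x + Ω_V·y + Ω_U·z)². Then: (i) G is positive definite if and only if λ·Σ > 1; (ii) if λ·Σ < 1 then G is nondegenerate and equivalent over ℝ to the diagonal form x² + y² − z² (signature (2,1)); (iii) G is degenerate if and only if λ·Σ = 1. -/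
/-- The unipotent change of variables that completes squares, followed by
`(s, z, t) ↦ (t + s, t - s, z)`. -/
noncomputable def squareCompletion (α β γ : ℝ) : (Fin 3 → ℝ) ≃ₗ[ℝ] (Fin 3 → ℝ) where
  toFun v := ![v 2 + (v 0 - α * (v 1 - γ * v 2) - β * v 2),
    v 2 - (v 0 - α * (v 1 - γ * v 2) - β * v 2), v 1 - γ * v 2]
  invFun u := ![(u 0 - u 1) / 2 + α * u 2 + β * ((u 0 + u 1) / 2),
    u 2 + γ * ((u 0 + u 1) / 2), (u 0 + u 1) / 2]
  map_add' v w := by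
    ext i; fin_cases i <;> simp <;> ring
  map_smul' c v := by
    ext i; fin_cases i <;> simp <;> ring
  left_inv v := by
    ext i; fin_cases i <;> simp
    ring
  right_inv v := by
    ext i; fin_cases i <;> simp <;> ring

/-- The form is diagonalizable with two positive coefficients and a third one of the sign of
`l * (a * b + b * c + c * a) - 1`. -/
theorem exists_diagonalization (a b c l : ℝ) (hl : 0 < l) :
    ∃ (e : (Fin 3 → ℝ) ≃ₗ[ℝ] (Fin 3 → ℝ)) (p q k : ℝ), 0 < p ∧ 0 < q ∧ 0 < k ∧
      ∀ v : Fin 3 → ℝ,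
        (e v 0) ^ 2 + (e v 1) ^ 2 + (e v 2) ^ 2
          - 2 * (e v 0) * (e v 1) - 2 * (e v 0) * (e v 2) - 2 * (e v 1) * (e v 2)
          + l * (a * (e v 0) + b * (e v 1) + c * (e v 2)) ^ 2
        = p * (v 0) ^ 2 + q * (v 1) ^ 2
          + k * (l * (a * b + b * c + c * a) - 1) * (v 2) ^ 2 := by
  obtain ⟨P, hP⟩ : ∃ P, P = 4 + l * (a - b) ^ 2 := ⟨_, rfl⟩
  obtain ⟨K, hK⟩ : ∃ K, K = P + 4 * l * c ^ 2 := ⟨_, rfl⟩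
  have hP0 : 0 < P := by rw [hP]; positivity
  have hK0 : 0 < K := by rw [hK]; positivity
  refine ⟨squareCompletion (l * (a - b) * c / P) (l * (a - b) * (a + b) / P)
    ((-2 * P + 4 * l * (a + b) * c) / K), P, K / P, 16 / K, hP0, by positivity, by positivity,
    fun v => ?_⟩
  simp only [squareCompletion, LinearEquiv.coe_mk, LinearMap.coe_mk, AddHom.coe_mk,
    Matrix.cons_val]
  field_simp
  subst hK
  subst hP
  ring

/-- Rescaling of the coordinates by nonzero factors. -/
noncomputable def coordinateScaling (d : Fin 3 → ℝ) (hd : ∀ i, d i ≠ 0) :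
    (Fin 3 → ℝ) ≃ₗ[ℝ] (Fin 3 → ℝ) :=
  LinearEquiv.piCongrRight fun i => LinearEquiv.smulOfNeZero ℝ ℝ (d i) (hd i)

/-- A diagonal ternary form with coefficients of signs `+, +, -` can be normalized. -/
theorem exists_normalization {p q r : ℝ} (hp : 0 < p) (hq : 0 < q) (hr : r < 0) :
    ∃ e : (Fin 3 → ℝ) ≃ₗ[ℝ] (Fin 3 → ℝ), ∀ v : Fin 3 → ℝ,
      p * (e v 0) ^ 2 + q * (e v 1) ^ 2 + r * (e v 2) ^ 2
        = (v 0) ^ 2 + (v 1) ^ 2 - (v 2) ^ 2 := by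
  have hr' : 0 < -r := neg_pos.mpr hr
  refine ⟨coordinateScaling ![(√p)⁻¹, (√q)⁻¹, (√(-r))⁻¹] ?_, fun v => ?_⟩
  · intro i
    fin_cases i <;> simp [Real.sqrt_eq_zero', hp, hq, hr]
  · simp only [coordinateScaling, LinearEquiv.piCongrRight_apply, LinearEquiv.smulOfNeZero_apply,
      smul_eq_mul, Matrix.cons_val, mul_pow, inv_pow, Real.sq_sqrt hp.le, Real.sq_sqrt hq.le,
      Real.sq_sqrt hr'.le]
    field_simp [hr.ne]
    ring

/-- A vector in the radical of a diagonal ternary form is annihilated by each coefficient. -/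
theorem diagonal_radical {p q r : ℝ} {v : Fin 3 → ℝ}
    (h : ∀ w : Fin 3 → ℝ, p * (v 0 + w 0) ^ 2 + q * (v 1 + w 1) ^ 2 + r * (v 2 + w 2) ^ 2
      = p * (v 0) ^ 2 + q * (v 1) ^ 2 + r * (v 2) ^ 2
        + (p * (w 0) ^ 2 + q * (w 1) ^ 2 + r * (w 2) ^ 2)) :
    p * v 0 = 0 ∧ q * v 1 = 0 ∧ r * v 2 = 0 := by
  have h0 := h ![1, 0, 0]
  have h1 := h ![0, 1, 0]
  have h2 := h ![0, 0, 1]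
  simp only [Matrix.cons_val] at h0 h1 h2
  exact ⟨by linarith, by linarith, by linarith⟩


/-- Classification of the conic at infinity of an oval quadric patch (`λ > 0`):
`G` is positive definite iff `λΣ > 1` (ellipsoid); if `λΣ < 1` it is nondegenerate of
signature (2,1) (two-sheeted hyperboloid); it is degenerate iff `λΣ = 1` (elliptic
paraboloid). -/
theorem stmt_13 (ΩU ΩV ΩW lam : ℝ) (hU : ΩU ≠ 0) (hV : ΩV ≠ 0) (hW : ΩW ≠ 0)
    (hlam : 0 < lam)
    (Sig : ℝ) (hSig : Sig = ΩU * ΩV + ΩV * ΩW + ΩW * ΩU)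
    (G : (Fin 3 → ℝ) → ℝ)
    (hG : ∀ v : Fin 3 → ℝ, G v =
      (v 0) ^ 2 + (v 1) ^ 2 + (v 2) ^ 2
        - 2 * (v 0) * (v 1) - 2 * (v 0) * (v 2) - 2 * (v 1) * (v 2)
        + lam * (ΩW * (v 0) + ΩV * (v 1) + ΩU * (v 2)) ^ 2) :
    ((∀ v : Fin 3 → ℝ, v ≠ 0 → 0 < G v) ↔ 1 < lam * Sig) ∧
    (lam * Sig < 1 →
      (∀ v : Fin 3 → ℝ, (∀ w : Fin 3 → ℝ, G (v + w) = G v + G w) → v = 0) ∧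
      ∃ e : (Fin 3 → ℝ) ≃ₗ[ℝ] (Fin 3 → ℝ),
        ∀ v : Fin 3 → ℝ, G (e v) = (v 0) ^ 2 + (v 1) ^ 2 - (v 2) ^ 2) ∧
    ((∃ v : Fin 3 → ℝ, v ≠ 0 ∧ ∀ w : Fin 3 → ℝ, G (v + w) = G v + G w) ↔
      lam * Sig = 1) := by
  obtain ⟨e, p, q, k, hp, hq, hk, he⟩ := exists_diagonalization ΩW ΩV ΩU lam hlam
  have hS : ΩW * ΩV + ΩV * ΩU + ΩU * ΩW = Sig := by rw [hSig]; ring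
  have hGe (v : Fin 3 → ℝ) : G (e v) =
      p * (v 0) ^ 2 + q * (v 1) ^ 2 + k * (lam * Sig - 1) * (v 2) ^ 2 := by
    rw [hG, he, hS]
  have hrad (v : Fin 3 → ℝ) (hv : ∀ w, G (v + w) = G v + G w) (hne : lam * Sig ≠ 1) :
      v = 0 := by
    obtain ⟨u, rfl⟩ := e.surjective v
    have hr : k * (lam * Sig - 1) ≠ 0 := mul_ne_zero hk.ne' (sub_ne_zero.mpr hne)
    obtain ⟨h0, h1, h2⟩ := diagonal_radical (v := u) fun w => by
      simpa only [← map_add, hGe, Pi.add_apply] using hv (e w)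
    have hu : u = 0 := by
      ext i
      fin_cases i
      · exact (mul_eq_zero.mp h0).resolve_left hp.ne'
      · exact (mul_eq_zero.mp h1).resolve_left hq.ne'
      · exact (mul_eq_zero.mp h2).resolve_left hr
    rw [hu, map_zero]
  have hlast : e ![0, 0, 1] ≠ 0 := by
    rw [Ne, LinearEquiv.map_eq_zero_iff]
    intro h
    simpa using congrFun h 2
  refine ⟨⟨fun h => ?_, fun h v hv => ?_⟩, fun h => ⟨fun v hv => hrad v hv h.ne, ?_⟩,
    ⟨fun ⟨v, hv, hw⟩ => ?_, fun h => ⟨e ![0, 0, 1], hlast, fun w => ?_⟩⟩⟩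
  · have hpos := h _ hlast
    rw [hGe] at hpos
    have hpos' : 0 < k * (lam * Sig - 1) := by simpa using hpos
    linarith [pos_of_mul_pos_right hpos' hk.le]
  · obtain ⟨u, rfl⟩ := e.surjective v
    have hr : 0 < k * (lam * Sig - 1) := mul_pos hk (sub_pos.mpr h)
    obtain ⟨i, hi⟩ : ∃ i, u i ≠ 0 := Function.ne_iff.mp fun hu => hv ((congrArg e hu).trans (map_zero e))
    rw [hGe]
    fin_cases i <;> simp only [Fin.zero_eta, Fin.mk_one, Fin.reduceFinMk] at hi <;> positivity
  · obtain ⟨e', he'⟩ := exists_normalization hp hq (mul_neg_of_pos_of_neg hk (sub_neg.mpr h))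
    exact ⟨e'.trans e, fun v => by rw [LinearEquiv.trans_apply, hGe, he']⟩
  · by_contra hne
    exact hv (hrad v hw hne)
  · obtain ⟨u, rfl⟩ := e.surjective w
    rw [← map_add]
    simp only [hGe, h, Pi.add_apply, Matrix.cons_val]
    ring
end

section
/- Let λ, Ω_U, Ω_V, Ω_W be real numbers with λ ≠ 0, Ω_U ≠ 0, Ω_V ≠ 0, Ω_W ≠ 0, λ·Ω_W² + 1 ≠ 0 and Ω_V + Ω_W ≠ 0. For all real p, q, r, define σ₁ := p/Ω_W + ((Ω_V·Ω_W·λ − 1)/(Ω_W²·λ + 1))·(q/Ω_V) + ((Ω_U·Ω_W·λ − 1)/(Ω_W²·λ + 1))·(r/Ω_U), σ₂ := (Ω_V + Ω_W)·(q/Ω_V) + ((Ω_U·Ω_V + Ω_V·Ω_W + Ω_W·Ω_U − Ω_W² − 2/λ)/(Ω_V + Ω_W))·(r/Ω_U), and σ₃ := (2/(Ω_V + Ω_W))·(r/Ω_U). Then p²/Ω_W² + q²/Ω_V² + r²/Ω_U² − 2pq/(Ω_W·Ω_V) − 2pr/(Ω_W·Ω_U) − 2qr/(Ω_V·Ω_U)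 + λ·(p + q + r)² = (Ω_W²·λ + 1)·σ₁² + (λ/(Ω_W²·λ + 1))·σ₂² + (Ω_U·Ω_V + Ω_V·Ω_W + Ω_W·Ω_U − 1/λ)·σ₃². -/
/-- Diagonalisation of the quadratic form of the conic at infinity (Section 5 of the
paper) by the linear forms `σ₁, σ₂, σ₃`. -/
theorem stmt_14 (lam ΩU ΩV ΩW : ℝ)
    (hlam : lam ≠ 0) (hU : ΩU ≠ 0) (hV : ΩV ≠ 0) (hW : ΩW ≠ 0)
    (h1 : lam * ΩW ^ 2 + 1 ≠ 0) (h2 : ΩV + ΩW ≠ 0) :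
    ∀ p q r : ℝ,
      p ^ 2 / ΩW ^ 2 + q ^ 2 / ΩV ^ 2 + r ^ 2 / ΩU ^ 2
          - 2 * p * q / (ΩW * ΩV) - 2 * p * r / (ΩW * ΩU) - 2 * q * r / (ΩV * ΩU)
          + lam * (p + q + r) ^ 2 =
        (ΩW ^ 2 * lam + 1) *
            (p / ΩW + ((ΩV * ΩW * lam - 1) / (ΩW ^ 2 * lam + 1)) * (q / ΩV)
              + ((ΩU * ΩW * lam - 1) / (ΩW ^ 2 * lam + 1)) * (r / ΩU)) ^ 2
          + (lam / (ΩW ^ 2 * lam + 1)) *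
            ((ΩV + ΩW) * (q / ΩV)
              + ((ΩU * ΩV + ΩV * ΩW + ΩW * ΩU - ΩW ^ 2 - 2 / lam) / (ΩV + ΩW))
                * (r / ΩU)) ^ 2
          + (ΩU * ΩV + ΩV * ΩW + ΩW * ΩU - 1 / lam) *
            ((2 / (ΩV + ΩW)) * (r / ΩU)) ^ 2 := by
  intro p q r
  have h3 : ΩW ^ 2 * lam + 1 ≠ 0 := by rwa [mul_comm]
  field_simp
  ring
end

section
/- Let U, V, W be vectors in ℝ³ (with the standard inner product and cross product) and let a, b, c, d be real numbers. Define v₁ := (b − d)·U + (d − c)·V, v₂ := (a − d)·V + (d − b)·W, v₃ := (d − a)·U + (c − d)·W, and n := (a − d)·(U × V) + (c − d)·(V × W) + (b − d)·(W × U). Then: (i) the linear map φ : ℝ³ → ℝ determined on the span of U, V, W by φ(α·U + β·V + γ·W) = (c − d)·α + (b − d)·β + (a − d)·γ (assuming U, V, W linearly independent) satisfies φ(v₁) = φ(v₂) = φ(v₃) = 0; and (ii) ⟨n, v₁⟩ = ⟨n, v₂⟩ = ⟨n, v₃⟩ = 0, so n is orthogonal to v₁, v₂ and v₃. -/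
open Matrix

/-- Lemma 1 of the paper: the plane with linear form `a·p + b·q + c·r + d·t` contains
the vectors `v₁, v₂, v₃`, and `n` is a normal vector to them. -/
theorem stmt_15 (U V W : Fin 3 → ℝ) (a b c d : ℝ)
    (v₁ v₂ v₃ n : Fin 3 → ℝ)
    (hv₁ : v₁ = (b - d) • U + (d - c) • V)
    (hv₂ : v₂ = (a - d) • V + (d - b) • W)
    (hv₃ : v₃ = (d - a) • U + (c - d) • W)
    (hn : n = (a - d) • (crossProduct U V) + (c - d) • (crossProduct V W)
      + (b - d) • (crossProduct W U))
    (hind : LinearIndependent ℝ ![U, V, W])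
    (φ : (Fin 3 → ℝ) →ₗ[ℝ] ℝ)
    (hφ : ∀ α β γ : ℝ, φ (α • U + β • V + γ • W) =
      (c - d) * α + (b - d) * β + (a - d) * γ) :
    (φ v₁ = 0 ∧ φ v₂ = 0 ∧ φ v₃ = 0) ∧
    (n ⬝ᵥ v₁ = 0 ∧ n ⬝ᵥ v₂ = 0 ∧ n ⬝ᵥ v₃ = 0) := by
  subst hv₁ hv₂ hv₃ hn
  refine ⟨⟨?_, ?_, ?_⟩, ?_, ?_, ?_⟩
  · have h := hφ (b - d) (d - c) 0
    rw [zero_smul, add_zero] at h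
    rw [h]
    ring
  · have h := hφ 0 (a - d) (d - b)
    rw [zero_smul, zero_add] at h
    rw [h]
    ring
  · have h := hφ (d - a) 0 (c - d)
    rw [zero_smul, add_zero] at h
    rw [h]
    ring
  all_goals
    simp [cross_apply, dotProduct, Fin.sum_univ_three]
    ring
end

section
/- Let λ, Ω_U, Ω_V, Ω_W be real numbers with Ω_U, Ω_V, Ω_W nonzero, and set Σ := Ω_U·Ω_V + Ω_V·Ω_W + Ω_W·Ω_U. Then the determinant of the 3×3 real matrix with rows [λ − 1/(Ω_W·Ω_U), λ − 1/(Ω_W·Ω_V), λ + 1/Ω_W²], [λ − 1/(Ω_V·Ω_U), λ + 1/Ω_V², λ − 1/(Ω_V·Ω_W)], [λ + 1/Ω_U², λ − 1/(Ω_U·Ω_V), λ − 1/(Ω_U·Ω_W)] equals −4·(λ·Σ − 1)/(Ω_U·Ω_V·Ω_W)². In particular, this determinant vanishes if and only if λ·Σ = 1. -/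
/-- The characteristic determinant of Corollary 3 of the paper, evaluated at `μ = 0`,
equals `−4(λΣ − 1)/(Ω_U Ω_V Ω_W)²`; it vanishes iff `λΣ = 1`, i.e. exactly for
paraboloids. -/
theorem stmt_16 (lam ΩU ΩV ΩW : ℝ) (hU : ΩU ≠ 0) (hV : ΩV ≠ 0) (hW : ΩW ≠ 0)
    (Sig : ℝ) (hSig : Sig = ΩU * ΩV + ΩV * ΩW + ΩW * ΩU) :
    (!![lam - 1 / (ΩW * ΩU), lam - 1 / (ΩW * ΩV), lam + 1 / ΩW ^ 2;
        lam - 1 / (ΩV * ΩU), lam + 1 / ΩV ^ 2, lam - 1 / (ΩV * ΩW);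
        lam + 1 / ΩU ^ 2, lam - 1 / (ΩU * ΩV), lam - 1 / (ΩU * ΩW)] :
          Matrix (Fin 3) (Fin 3) ℝ).det =
      -4 * (lam * Sig - 1) / (ΩU * ΩV * ΩW) ^ 2 ∧
    ((!![lam - 1 / (ΩW * ΩU), lam - 1 / (ΩW * ΩV), lam + 1 / ΩW ^ 2;
         lam - 1 / (ΩV * ΩU), lam + 1 / ΩV ^ 2, lam - 1 / (ΩV * ΩW);
         lam + 1 / ΩU ^ 2, lam - 1 / (ΩU * ΩV), lam - 1 / (ΩU * ΩW)] :
           Matrix (Fin 3) (Fin 3) ℝ).det = 0 ↔ lam * Sig = 1) := by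
  have hdet : (!![lam - 1 / (ΩW * ΩU), lam - 1 / (ΩW * ΩV), lam + 1 / ΩW ^ 2;
        lam - 1 / (ΩV * ΩU), lam + 1 / ΩV ^ 2, lam - 1 / (ΩV * ΩW);
        lam + 1 / ΩU ^ 2, lam - 1 / (ΩU * ΩV), lam - 1 / (ΩU * ΩW)] :
          Matrix (Fin 3) (Fin 3) ℝ).det =
      -4 * (lam * Sig - 1) / (ΩU * ΩV * ΩW) ^ 2 := by
    rw [Matrix.det_fin_three]
    simp only [Matrix.of_apply, Matrix.cons_val]
    subst hSig
    field_simp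
    ring
  refine ⟨hdet, ?_⟩
  have hne : (ΩU * ΩV * ΩW) ^ 2 ≠ 0 := by positivity
  rw [hdet, div_eq_zero_iff, or_iff_left hne, mul_eq_zero, or_iff_right (by norm_num), sub_eq_zero]
end

section
/- Let E be a real vector space, let U, V, W, T ∈ E, let ω₀₀₂, ω₀₂₀, ω₂₀₀, ω_u, ω_v, ω_w be nonzero real numbers, let Ω_U, Ω_V, Ω_W be real numbers, and assume D' := Ω_U·ω_u + Ω_V·ω_v + Ω_W·ω_w − 2·ω_u·ω_v·ω_w ≠ 0. Define P := (Ω_U·U + Ω_V·V)/(2·ω₀₀₂·ω_w), Q := (Ω_W·W + Ω_U·U)/(2·ω₀₂₀·ω_v), R := (Ω_V·V + Ω_W·W)/(2·ω₂₀₀·ω_u), and S := (Ω_U/(2·ω_v·ω_w))·U + (Ω_V/(2·ω_u·ω_w))·V + (Ω_W/(2·ω_u·ω_v))·W + ((2·ω_u·ω_v·ω_w − Ω_U·ω_u − Ω_V·ω_v − Ω_W·ω_w)/(2·ω_u·ω_v·ω_w))·T. Then T = (ω₀₀₂·ω_w·(ω_u + ω_v − ω_w)·P + ω₀₂₀·ω_v·(ω_u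 − ω_v + ω_w)·Q + ω₂₀₀·ω_u·(−ω_u + ω_v + ω_w)·R − 2·ω_u·ω_v·ω_w·S)/D'. -/
/-- Formula (TTT) of Theorem 1 of the paper: the vertex `T` of the tangent cone as a
barycentric combination of the corner points `P, Q, R` and the common point `S` of the
boundary conics, in the case where all reference points are proper. -/
theorem stmt_17 (E : Type*) [AddCommGroup E] [Module ℝ E]
    (U V W T : E)
    (ω002 ω020 ω200 ωu ωv ωw : ℝ)
    (h002 : ω002 ≠ 0) (h020 : ω020 ≠ 0) (h200 : ω200 ≠ 0)
    (hu : ωu ≠ 0) (hv : ωv ≠ 0) (hw : ωw ≠ 0)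
    (ΩU ΩV ΩW : ℝ)
    (D' : ℝ) (hD' : D' = ΩU * ωu + ΩV * ωv + ΩW * ωw - 2 * ωu * ωv * ωw)
    (hD'0 : D' ≠ 0)
    (P Q R S : E)
    (hP : P = (2 * ω002 * ωw)⁻¹ • (ΩU • U + ΩV • V))
    (hQ : Q = (2 * ω020 * ωv)⁻¹ • (ΩW • W + ΩU • U))
    (hR : R = (2 * ω200 * ωu)⁻¹ • (ΩV • V + ΩW • W))
    (hS : S = (ΩU / (2 * ωv * ωw)) • U + (ΩV / (2 * ωu * ωw)) • V
      + (ΩW / (2 * ωu * ωv)) • W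
      + ((2 * ωu * ωv * ωw - ΩU * ωu - ΩV * ωv - ΩW * ωw) / (2 * ωu * ωv * ωw)) • T) :
    T = (D')⁻¹ • ((ω002 * ωw * (ωu + ωv - ωw)) • P
      + (ω020 * ωv * (ωu - ωv + ωw)) • Q
      + (ω200 * ωu * (-ωu + ωv + ωw)) • R
      - (2 * ωu * ωv * ωw) • S) := by
  rw [eq_inv_smul_iff₀ hD'0]
  subst hP hQ hR hS hD'
  match_scalars <;> field_simp <;> ring
end
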